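/- Let N be a strictly convex and smooth norm on ℝ^{2n}. Then every infinite geodesic γ:ℝ→ℍⁿ with respect to the sub-Finsler metric d_SF associated to N is a horizontal line, i.e. of the form γ(s)=g₀*(s w, 0) for some g₀∈ℍⁿ and w∈ℝ^{2n} with N(w)=1. -/

import Mathlib

open MeasureTheory Set

noncomputable section

/-- `ℝ^{2n}`, with the Euclidean norm. -/
abbrev V (n : ℕ) := EuclideanSpace ℝ (Fin (2 * n))

/-- The `n`-th Heisenberg group as a set: `ℝ^{2n} × ℝ`. -/
abbrev Heis (n : ℕ) := V n × ℝ

/-- Euclidean dot product on `ℝ^{2n}`. -/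
def dot {n : ℕ} (p z : V n) : ℝ := ∑ i, p i * z i

/-- Index `i` as an element of the first half of `Fin (2n)`. -/
def fstIdx {n : ℕ} (i : Fin n) : Fin (2 * n) := ⟨i.1, by have := i.isLt; omega⟩

/-- Index `n + i` as an element of the second half of `Fin (2n)`. -/
def sndIdx {n : ℕ} (i : Fin n) : Fin (2 * n) := ⟨n + i.1, by have := i.isLt; omega⟩

/-- The symplectic form `⟨z, J_n z'⟩ = ∑ (y_i x'_i - x_i y'_i)` on `ℝ^{2n}`. -/
def symp {n : ℕ} (z z' : V n) : ℝ :=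
  ∑ i : Fin n, (z (sndIdx i) * z' (fstIdx i) - z (fstIdx i) * z' (sndIdx i))

/-- Heisenberg group multiplication. -/
def hmul {n : ℕ} (g g' : Heis n) : Heis n :=
  (g.1 + g'.1, g.2 + g'.2 + 2 * symp g.1 g'.1)

/-- Heisenberg group inverse. -/
def hinv {n : ℕ} (g : Heis n) : Heis n := (-g.1, -g.2)

/-- Heisenberg dilation `δ_λ(z,t) = (λ z, λ² t)`. -/
def dil {n : ℕ} (l : ℝ) (g : Heis n) : Heis n := (l • g.1, l ^ 2 * g.2)

/-- `N : ℝ^{2n} → ℝ` is a norm. -/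
structure IsNorm {n : ℕ} (N : V n → ℝ) : Prop where
  nonneg : ∀ z, 0 ≤ N z
  eq_zero_iff : ∀ z, N z = 0 ↔ z = 0
  smul : ∀ (a : ℝ) (z : V n), N (a • z) = |a| * N z
  triangle : ∀ z z', N (z + z') ≤ N z + N z'

/-- `N` is a strictly convex norm: additivity of the norm forces positive collinearity. -/
def StrictlyConvexNorm {n : ℕ} (N : V n → ℝ) : Prop :=
  ∀ z z' : V n, z ≠ 0 → z' ≠ 0 → N (z + z') = N z + N z' →
    ∃ α : ℝ, 0 < α ∧ z' = α • z

/-- The subdifferential of `f : ℝ^{2n} → ℝ` at `z`. -/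
def subdiff {n : ℕ} (f : V n → ℝ) (z : V n) : Set (V n) :=
  {p | ∀ z', f z + dot p (z' - z) ≤ f z'}

/-- A norm is smooth if its subdifferential is a singleton away from the origin. -/
def SmoothNorm {n : ℕ} (N : V n → ℝ) : Prop :=
  ∀ z : V n, z ≠ 0 → ∃ p : V n, subdiff N z = {p}

/-- The dual norm `N_*(p) = sup { p·z : N(z) = 1 }`. -/
def dualN {n : ℕ} (N : V n → ℝ) (p : V n) : ℝ :=
  sSup ((fun z => dot p z) '' {z | N z = 1})

/-- `F_N(z) = ½ N(z)²`. -/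
def FN {n : ℕ} (N : V n → ℝ) (z : V n) : ℝ := (1 / 2) * (N z) ^ 2

/-- The Legendre transform `f*(p) = sup_z (p·z - f(z))`. -/
def legendre {n : ℕ} (f : V n → ℝ) (p : V n) : ℝ :=
  ⨆ z : V n, (dot p z - f z)

/-- A horizontal (absolutely continuous) curve on `[a,b]`, encoded via an integrable
horizontal velocity `v = γ̇_I` together with the integral form of the horizontality
condition for the last coordinate. -/
structure HorizCurve (n : ℕ) (a b : ℝ) where
  γ : ℝ → Heis n
  v : ℝ → V n
  intg : IntegrableOn v (Icc a b)
  pos : ∀ s ∈ Icc a b, (γ s).1 = (γ a).1 + ∫ u in a..s, v u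
  vert : ∀ s ∈ Icc a b, (γ s).2 = (γ a).2 + ∫ u in a..s, 2 * symp ((γ u).1) (v u)

/-- The sub-Finsler distance associated to the norm `N` on `ℍⁿ`. -/
def dSF (n : ℕ) (N : V n → ℝ) (g g' : Heis n) : ℝ :=
  sInf { L | ∃ (a b : ℝ) (c : HorizCurve n a b), a ≤ b ∧ c.γ a = g ∧ c.γ b = g' ∧
    L = ∫ s in a..b, N (c.v s) }

/-- Horizontal projection of the trajectory of the control `v`,
solving `γ̇_I = -v`, `γ_I(0) = 0`. -/
def trajI (n : ℕ) (v : ℝ → V n) (s : ℝ) : V n := -∫ u in (0:ℝ)..s, v u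

/-- The trajectory of the control `v`: solves `ẋ_i = -v_i`, `ẏ_i = -v_{n+i}`,
`ṫ = -2∑(y_i v_i - x_i v_{n+i})`, starting at the neutral element. -/
def traj (n : ℕ) (v : ℝ → V n) (s : ℝ) : Heis n :=
  (trajI n v s, -∫ u in (0:ℝ)..s, 2 * symp (trajI n v u) (v u))

/-- `v` is an admissible control steering `e` to `g` in time `T`. -/
def Admissible (n : ℕ) (T : ℝ) (g : Heis n) (v : ℝ → V n) : Prop :=
  IntegrableOn v (Icc 0 T) ∧ traj n v T = g

/-- `v` is optimal for the energy problem (P). -/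
def OptimalEnergy (n : ℕ) (N : V n → ℝ) (T : ℝ) (g : Heis n) (v : ℝ → V n) : Prop :=
  Admissible n T g v ∧ ∀ w : ℝ → V n, Admissible n T g w →
    (∫ s in (0:ℝ)..T, FN N (v s)) ≤ ∫ s in (0:ℝ)..T, FN N (w s)

/-- `v` is optimal for the length problem. -/
def OptimalLength (n : ℕ) (N : V n → ℝ) (T : ℝ) (g : Heis n) (v : ℝ → V n) : Prop :=
  Admissible n T g v ∧ ∀ w : ℝ → V n, Admissible n T g w →
    (∫ s in (0:ℝ)..T, N (v s)) ≤ ∫ s in (0:ℝ)..T, N (w s)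

/-- The standard symplectic matrix `J_n` acting on `ℝ^{2n}`:
`(J z)_i = -z_{n+i}`, `(J z)_{n+i} = z_i`. -/
def Jmat (n : ℕ) (z : V n) : V n :=
  (EuclideanSpace.equiv (Fin (2 * n)) ℝ).symm
    (fun j => if h : (j : ℕ) < n then -z ⟨n + (j : ℕ), by have := j.isLt; omega⟩
      else z ⟨(j : ℕ) - n, by have := j.isLt; omega⟩)

/-- The function `a` associated to a multiplier `λ` (with `λ_{2n+1} ≡ k`) and a control `v`:
`a_i = λ_i + 2k y_i`, `a_{n+i} = λ_{n+i} - 2k x_i`, where `(x,y) = γ_I` is the horizontal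
projection of the trajectory of `v`. -/
def afun (n : ℕ) (v : ℝ → V n) (lam : ℝ → V n) (k : ℝ) (s : ℝ) : V n :=
  lam s - (2 * k) • Jmat n (trajI n v s)

/-- A Pontryagin multiplier `(λ₀, λ)` for the control `v` on `[0,T]` for problem (P):
`λ = (λ_I, k)` with `λ_{2n+1} ≡ k` constant, `λ̇_i = -2k v_{n+i}`, `λ̇_{n+i} = 2k v_i`
(in integrated form), nontriviality, the pointwise minimum principle, and constancy
of the minimized Hamiltonian. -/
structure PMP (n : ℕ) (N : V n → ℝ) (T : ℝ) (v : ℝ → V n) (l0 : ℝ) where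
  lam : ℝ → V n
  k : ℝ
  lam_eq : ∀ s ∈ Icc (0:ℝ) T,
    lam s = lam 0 + (2 * k) • ∫ u in (0:ℝ)..s, Jmat n (v u)
  nontriv : ¬(l0 = 0 ∧ k = 0 ∧ lam 0 = 0)
  argmin : ∀ s ∈ Icc (0:ℝ) T, ∀ u : V n,
    l0 * FN N (v s) - dot (afun n v lam k s) (v s) ≤ l0 * FN N u - dot (afun n v lam k s) u
  isConst : ∃ c : ℝ, ∀ s ∈ Icc (0:ℝ) T,
    l0 * FN N (v s) - dot (afun n v lam k s) (v s) = c

/-- A homogeneous norm on the Heisenberg group `ℍⁿ`. -/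
structure IsHomNorm {n : ℕ} (Nh : Heis n → ℝ) : Prop where
  nonneg : ∀ g, 0 ≤ Nh g
  eq_zero_iff : ∀ g, Nh g = 0 ↔ g = ((0 : V n), (0 : ℝ))
  symm : ∀ g, Nh (hinv g) = Nh g
  triangle : ∀ g g', Nh (hmul g g') ≤ Nh g + Nh g'
  homog : ∀ l : ℝ, 0 < l → ∀ g, Nh (dil l g) = l * Nh g

/-- The geodesic linearity property: every infinite geodesic of `(ℍⁿ, d)` is an affine
line in `ℝ^{2n+1}`. -/
def GLP (n : ℕ) (d : Heis n → Heis n → ℝ) : Prop :=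
  ∀ γ : ℝ → Heis n, (∀ s s' : ℝ, d (γ s) (γ s') = |s - s'|) →
    ∃ p u : Heis n, ∀ s : ℝ, γ s = p + s • u

/-- An infinite multiplier for the control `v` on `[0,∞)`. -/
def IsInfMult (n : ℕ) (N : V n → ℝ) (v : ℝ → V n) (lam : ℝ → V n) (k : ℝ) : Prop :=
  ∀ T : ℝ, 0 < T → ∃ m : PMP n N T v 1, m.lam = lam ∧ m.k = k

section Symp

/-- The symplectic form as a continuous bilinear map. -/
def sympL (n : ℕ) : V n →L[ℝ] V n →L[ℝ] ℝ :=
  LinearMap.toContinuousBilinearMap (LinearMap.mk₂ ℝ (symp (n := n))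
    (by intro a b c; simp only [symp, ← Finset.sum_add_distrib]
        exact Finset.sum_congr rfl fun i _ => by simp; ring)
    (by intro a b c; simp only [symp, smul_eq_mul, Finset.mul_sum]
        exact Finset.sum_congr rfl fun i _ => by simp; ring)
    (by intro a b c; simp only [symp, ← Finset.sum_add_distrib]
        exact Finset.sum_congr rfl fun i _ => by simp; ring)
    (by intro a b c; simp only [symp, smul_eq_mul, Finset.mul_sum]
        exact Finset.sum_congr rfl fun i _ => by simp; ring))

theorem symp_eq_sympL {n : ℕ} (a b : V n) : symp a b = sympL n a b := by
  simp [sympL]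

theorem symp_self {n : ℕ} (a : V n) : symp a a = 0 := by
  simp only [symp]
  exact Finset.sum_eq_zero fun i _ => by ring

theorem symp_swap {n : ℕ} (a b : V n) : symp a b = -symp b a := by
  simp only [symp, ← Finset.sum_neg_distrib]
  exact Finset.sum_congr rfl fun i _ => by ring

theorem symp_add_left {n : ℕ} (a b c : V n) : symp (a + b) c = symp a c + symp b c := by
  simp [symp_eq_sympL]

theorem symp_add_right {n : ℕ} (a b c : V n) : symp a (b + c) = symp a b + symp a c := by
  simp [symp_eq_sympL]

theorem symp_smul_left {n : ℕ} (r : ℝ) (a b : V n) : symp (r • a) b = r * symp a b := by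
  simp [symp_eq_sympL]

theorem symp_smul_right {n : ℕ} (r : ℝ) (a b : V n) : symp a (r • b) = r * symp a b := by
  simp [symp_eq_sympL]

theorem symp_neg_left {n : ℕ} (a b : V n) : symp (-a) b = -symp a b := by
  simp [symp_eq_sympL]

theorem symp_neg_right {n : ℕ} (a b : V n) : symp a (-b) = -symp a b := by
  simp [symp_eq_sympL]

theorem symp_zero_left {n : ℕ} (a : V n) : symp 0 a = 0 := by
  simp [symp_eq_sympL]

theorem symp_zero_right {n : ℕ} (a : V n) : symp a 0 = 0 := by
  simp [symp_eq_sympL]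

theorem exists_abs_symp_le (n : ℕ) : ∃ K : ℝ, 0 ≤ K ∧ ∀ a b : V n, |symp a b| ≤ K * ‖a‖ * ‖b‖ :=
  ⟨‖sympL n‖, norm_nonneg (sympL n), fun a b => by
    rw [symp_eq_sympL, ← Real.norm_eq_abs]; exact (sympL n).le_opNorm₂ a b⟩

theorem sum_fin_two_mul {n : ℕ} (f : Fin (2 * n) → ℝ) :
    ∑ j, f j = ∑ i : Fin n, (f (fstIdx i) + f (sndIdx i)) := by
  have h : n + n = 2 * n := by omega
  rw [← (finCongr h).sum_comp, Fin.sum_univ_add, Finset.sum_add_distrib]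
  rfl

theorem Jmat_fstIdx {n : ℕ} (z : V n) (i : Fin n) : Jmat n z (fstIdx i) = -z (sndIdx i) := by
  simp [Jmat, fstIdx, sndIdx]

theorem Jmat_sndIdx {n : ℕ} (z : V n) (i : Fin n) : Jmat n z (sndIdx i) = z (fstIdx i) := by
  simp [Jmat, fstIdx, sndIdx]

theorem norm_sq_eq_sum {n : ℕ} (z : V n) :
    ‖z‖ ^ 2 = ∑ i : Fin n, (z (fstIdx i) ^ 2 + z (sndIdx i) ^ 2) := by
  rw [EuclideanSpace.real_norm_sq_eq, sum_fin_two_mul]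

theorem norm_Jmat {n : ℕ} (z : V n) : ‖Jmat n z‖ = ‖z‖ := by
  rw [← sq_eq_sq₀ (norm_nonneg _) (norm_nonneg _), norm_sq_eq_sum, norm_sq_eq_sum]
  refine Finset.sum_congr rfl fun i _ => ?_
  rw [Jmat_fstIdx, Jmat_sndIdx]; ring

theorem symp_Jmat_self {n : ℕ} (z : V n) : symp (Jmat n z) z = ‖z‖ ^ 2 := by
  rw [norm_sq_eq_sum, symp]
  refine Finset.sum_congr rfl fun i _ => ?_
  rw [Jmat_fstIdx, Jmat_sndIdx]; ring

theorem intervalIntegrable_symp {n : ℕ} {a b : ℝ} {x v : ℝ → V n}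
    (hx : ContinuousOn x (uIcc a b)) (hv : IntervalIntegrable v volume a b) :
    IntervalIntegrable (fun u => symp (x u) (v u)) volume a b := by
  have hcoord : ∀ j, IntervalIntegrable (fun u => v u j) volume a b := fun j =>
    ⟨(EuclideanSpace.proj (𝕜 := ℝ) j).integrable_comp hv.1,
      (EuclideanSpace.proj (𝕜 := ℝ) j).integrable_comp hv.2⟩
  have hxc : ∀ j, ContinuousOn (fun u => x u j) (uIcc a b) := fun j =>
    (EuclideanSpace.proj (𝕜 := ℝ) j).continuous.comp_continuousOn hx
  unfold symp
  have := IntervalIntegrable.sum Finset.univ (μ := volume) (a := a) (b := b)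
    (f := fun (i : Fin n) u => x u (sndIdx i) * v u (fstIdx i) - x u (fstIdx i) * v u (sndIdx i))
    fun i _ => ((hcoord _).continuousOn_mul (hxc _)).sub ((hcoord _).continuousOn_mul (hxc _))
  refine this.congr fun u _ => ?_
  simp

theorem integral_symp_left {n : ℕ} {a b : ℝ} (z : V n) {v : ℝ → V n}
    (hv : IntervalIntegrable v volume a b) :
    ∫ u in a..b, symp z (v u) = symp z (∫ u in a..b, v u) := by
  simp only [symp_eq_sympL]
  exact (sympL n z).intervalIntegral_comp_comm hv

theorem continuousOn_primitive {n : ℕ} {a b : ℝ} {v : ℝ → V n}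
    (hv : IntervalIntegrable v volume a b) :
    ContinuousOn (fun u => ∫ r in a..u, v r) (uIcc a b) :=
  intervalIntegral.continuousOn_primitive_interval' hv left_mem_uIcc

theorem integral_symp_add {n : ℕ} {a b : ℝ} (z : V n) {x v : ℝ → V n}
    (hx : ContinuousOn x (uIcc a b)) (hv : IntervalIntegrable v volume a b) :
    ∫ u in a..b, 2 * symp (z + x u) (v u) =
      2 * symp z (∫ u in a..b, v u) + ∫ u in a..b, 2 * symp (x u) (v u) := by
  simp only [symp_add_left, intervalIntegral.integral_const_mul]
  rw [intervalIntegral.integral_add (intervalIntegrable_symp continuousOn_const hv)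
    (intervalIntegrable_symp hx hv), integral_symp_left z hv]
  ring

end Symp

namespace IsNorm

variable {n : ℕ} {N : V n → ℝ}

theorem map_zero (hN : IsNorm N) : N 0 = 0 := (hN.eq_zero_iff 0).2 rfl

theorem map_neg (hN : IsNorm N) (z : V n) : N (-z) = N z := by
  have := hN.smul (-1) z
  simpa using this

theorem exists_le_norm (hN : IsNorm N) : ∃ C : ℝ, 0 ≤ C ∧ ∀ z, N z ≤ C * ‖z‖ := by
  let e : Fin (2 * n) → V n := fun i => EuclideanSpace.single i 1
  refine ⟨∑ i, N (e i), Finset.sum_nonneg fun i _ => hN.nonneg _, fun z => ?_⟩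
  have hz : z = ∑ i, z i • e i := by
    ext j
    simp [e, Finset.sum_apply, Pi.single_apply]
  have hsum : ∀ s : Finset (Fin (2 * n)), N (∑ i ∈ s, z i • e i) ≤ ∑ i ∈ s, N (z i • e i) := by
    intro s
    induction s using Finset.induction_on with
    | empty => simp [hN.map_zero]
    | insert i s his ih =>
      rw [Finset.sum_insert his, Finset.sum_insert his]
      exact (hN.triangle _ _).trans (by gcongr)
  calc N z = N (∑ i, z i • e i) := by rw [← hz]
    _ ≤ ∑ i, N (z i • e i) := hsum _
    _ ≤ ∑ i, N (e i) * ‖z‖ := Finset.sum_le_sum fun i _ => by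
        rw [hN.smul, mul_comm]
        exact mul_le_mul_of_nonneg_left (PiLp.norm_apply_le z i) (hN.nonneg _)
    _ = _ := by rw [Finset.sum_mul]

theorem continuous (hN : IsNorm N) : Continuous N := by
  obtain ⟨C, hC, h⟩ := hN.exists_le_norm
  refine (LipschitzWith.of_le_add_mul (⟨C, hC⟩ : NNReal) fun x y => ?_).continuous
  calc N x = N (y + (x - y)) := by congr 1; abel
    _ ≤ N y + N (x - y) := hN.triangle _ _
    _ ≤ N y + C * dist x y := by rw [dist_eq_norm]; gcongr; exact h _

theorem exists_norm_le (hN : IsNorm N) : ∃ C : ℝ, 0 ≤ C ∧ ∀ z, ‖z‖ ≤ C * N z := by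
  rcases (Metric.sphere (0 : V n) 1).eq_empty_or_nonempty with he | hne
  · refine ⟨0, le_rfl, fun z => ?_⟩
    by_cases hz : z = 0
    · simp [hz]
    · have : ‖z‖⁻¹ • z ∈ Metric.sphere (0 : V n) 1 := by simp [norm_smul, hz]
      simp [he] at this
  · obtain ⟨z₀, hz₀, hmin⟩ :=
      (isCompact_sphere (0 : V n) 1).exists_isMinOn hne hN.continuous.continuousOn
    have hpos : 0 < N z₀ := by
      refine (hN.nonneg z₀).lt_of_ne fun h => ?_
      have := (hN.eq_zero_iff z₀).1 h.symm
      simp [this] at hz₀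
    refine ⟨(N z₀)⁻¹, by positivity, fun z => ?_⟩
    by_cases hz : z = 0
    · simp [hz, hN.map_zero]
    · have hm : ‖z‖⁻¹ • z ∈ Metric.sphere (0 : V n) 1 := by simp [norm_smul, hz]
      have h1 : N z₀ ≤ N (‖z‖⁻¹ • z) := hmin hm
      rw [hN.smul, abs_of_nonneg (by positivity)] at h1
      have hzp : 0 < ‖z‖ := norm_pos_iff.2 hz
      rw [inv_mul_eq_div, le_div_iff₀ hzp] at h1
      rw [inv_mul_eq_div, le_div_iff₀ hpos]
      linarith

theorem intervalIntegrable_comp (hN : IsNorm N) {a b : ℝ} {v : ℝ → V n}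
    (hv : IntervalIntegrable v volume a b) :
    IntervalIntegrable (fun u => N (v u)) volume a b := by
  obtain ⟨C, hC, h⟩ := hN.exists_le_norm
  have key : ∀ μ : Measure ℝ, Integrable v μ → Integrable (fun u => N (v u)) μ := fun μ hμ =>
    (hμ.norm.const_mul C).mono' (hN.continuous.comp_aestronglyMeasurable hμ.1)
      (Filter.Eventually.of_forall fun u => by
        rw [Real.norm_of_nonneg (hN.nonneg _)]; exact h _)
  exact ⟨key _ hv.1, key _ hv.2⟩

/-- A smooth norm does not increase under averaging, by testing against a subgradient. -/
theorem map_integral_le (hN : IsNorm N) (hsm : SmoothNorm N) {a b : ℝ} (hab : a ≤ b)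
    {v : ℝ → V n} (hv : IntervalIntegrable v volume a b) :
    N (∫ u in a..b, v u) ≤ ∫ u in a..b, N (v u) := by
  set z := ∫ u in a..b, v u with hz
  by_cases hz0 : z = 0
  · rw [hz0, hN.map_zero]
    exact intervalIntegral.integral_nonneg hab fun u _ => hN.nonneg _
  obtain ⟨p, hp⟩ := hsm z hz0
  have hp' : p ∈ subdiff N z := by rw [hp]; rfl
  have hdot : ∀ y, dot p y = inner ℝ p y := fun y => by
    simp [dot, PiLp.inner_apply, mul_comm]
  have hsub : ∀ y, N z + inner ℝ p (y - z) ≤ N y := fun y => by rw [← hdot]; exact hp' y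
  have h0 := hsub 0
  have h2 := hsub ((2 : ℝ) • z)
  rw [hN.smul, inner_sub_right, inner_smul_right, abs_of_pos two_pos] at h2
  rw [zero_sub, inner_neg_right, hN.map_zero] at h0
  have hNz : N z = inner ℝ p z := by linarith
  have hle : ∀ y, inner ℝ p y ≤ N y := fun y => by
    have := hsub y
    rw [inner_sub_right] at this
    linarith
  calc N z = innerSL ℝ p z := by rw [hNz]; simp
    _ = ∫ u in a..b, innerSL ℝ p (v u) := by
        rw [hz]; exact ((innerSL ℝ p).intervalIntegral_comp_comm hv).symm
    _ ≤ ∫ u in a..b, N (v u) := by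
        refine intervalIntegral.integral_mono_on hab
          ⟨(innerSL ℝ p).integrable_comp hv.1, (innerSL ℝ p).integrable_comp hv.2⟩
          (hN.intervalIntegrable_comp hv) fun u _ => ?_
        simpa using hle (v u)

end IsNorm

/-- There is a horizontal curve of `N`-length `L` from the neutral element to `p`. -/
def Reach {n : ℕ} (N : V n → ℝ) (p : Heis n) (L : ℝ) : Prop :=
  ∃ (T : ℝ) (v : ℝ → V n), 0 ≤ T ∧ IntervalIntegrable v volume 0 T ∧
    p.1 = ∫ u in (0:ℝ)..T, v u ∧
    p.2 = ∫ u in (0:ℝ)..T, 2 * symp (∫ r in (0:ℝ)..u, v r) (v u) ∧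
    L = ∫ u in (0:ℝ)..T, N (v u)

section Reach

variable {n : ℕ} {N : V n → ℝ}

theorem exists_horizCurve_iff_reach (g g' : Heis n) (L : ℝ) :
    (∃ (a b : ℝ) (c : HorizCurve n a b), a ≤ b ∧ c.γ a = g ∧ c.γ b = g' ∧
      L = ∫ s in a..b, N (c.v s)) ↔ Reach N (hmul (hinv g) g') L := by
  constructor
  · rintro ⟨a, b, c, hab, rfl, rfl, rfl⟩
    have hv : IntervalIntegrable c.v volume a b :=
      (intervalIntegrable_iff_integrableOn_Icc_of_le hab).2 c.intg
    have hx := c.pos b (right_mem_Icc.2 hab)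
    have ht := c.vert b (right_mem_Icc.2 hab)
    have hcongr : ∫ u in a..b, 2 * symp ((c.γ u).1) (c.v u) =
        ∫ u in a..b, 2 * symp ((c.γ a).1 + ∫ r in a..u, c.v r) (c.v u) := by
      refine intervalIntegral.integral_congr fun u hu => ?_
      rw [uIcc_of_le hab] at hu
      simp only [c.pos u hu]
    rw [hcongr, integral_symp_add _ (continuousOn_primitive hv) hv] at ht
    refine ⟨b - a, fun u => c.v (u + a), by linarith, ?_, ?_, ?_, ?_⟩
    · simpa using hv.comp_add_right a
    · simp only [hmul, hinv, hx, intervalIntegral.integral_comp_add_right]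
      simp
    · have hin : ∀ u, ∫ r in (0:ℝ)..u, c.v (r + a) = ∫ r in a..(u + a), c.v r := fun u => by
        rw [intervalIntegral.integral_comp_add_right, zero_add]
      simp only [hin]
      rw [intervalIntegral.integral_comp_add_right
        (fun u => 2 * symp (∫ r in a..u, c.v r) (c.v u)) a]
      simp only [hmul, hinv, hx, ht, symp_neg_left, symp_add_right, symp_self, zero_add,
        sub_add_cancel]
      ring
    · rw [intervalIntegral.integral_comp_add_right (fun u => N (c.v u)) a]
      simp
  · rintro ⟨T, v, hT, hv, hx, ht, rfl⟩
    let x : ℝ → V n := fun u => g.1 + ∫ r in (0:ℝ)..u, v r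
    let c : HorizCurve n 0 T :=
      { γ := fun s => (x s, g.2 + ∫ u in (0:ℝ)..s, 2 * symp (x u) (v u))
        v := v
        intg := (intervalIntegrable_iff_integrableOn_Icc_of_le hT).1 hv
        pos := fun s _ => by simp [x]
        vert := fun s _ => by simp }
    refine ⟨0, T, c, hT, by simp [c, x], ?_, rfl⟩
    simp only [hmul, hinv] at hx ht
    have hx' : g'.1 = g.1 + ∫ u in (0:ℝ)..T, v u := by rw [← hx]; abel
    refine Prod.ext ?_ ?_
    · simp [c, x, hx']
    · simp only [c, x]
      rw [integral_symp_add _ (continuousOn_primitive hv) hv, ← ht, hx', symp_neg_left,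
        symp_add_right, symp_self]
      ring

theorem dSF_eq_sInf_reach (g g' : Heis n) :
    dSF n N g g' = sInf {L | Reach N (hmul (hinv g) g') L} := by
  simp only [dSF, exists_horizCurve_iff_reach]

theorem reach_segment (w : V n) : Reach N (w, 0) (N w) := by
  refine ⟨1, fun _ => w, zero_le_one, by simp, by simp, ?_, by simp⟩
  simp [symp_smul_left, symp_self]

theorem Reach.mul (hN : IsNorm N) {p q : Heis n} {L M : ℝ} (hp : Reach N p L)
    (hq : Reach N q M) : Reach N (hmul p q) (L + M) := by
  obtain ⟨S, v, hS, hv, hpx, hpt, rfl⟩ := hp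
  obtain ⟨T, w, hT, hw, hqx, hqt, rfl⟩ := hq
  let y : ℝ → V n := fun u => if u ≤ S then v u else w (u - S)
  have hyv : ∀ u ≤ S, y u = v u := fun u hu => by simp [y, hu]
  have hyw : ∀ u, S < u → y u = w (u - S) := fun u hu => by simp [y, not_le.2 hu]
  have hw' : IntervalIntegrable (fun u => w (u - S)) volume S (S + T) := by
    simpa [add_comm] using hw.comp_sub_right S
  have hST : S ≤ S + T := by linarith
  have hy1 : IntervalIntegrable y volume 0 S :=
    hv.congr fun u hu => (hyv u (by rw [uIoc_of_le hS] at hu; exact hu.2)).symm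
  have hy2 : IntervalIntegrable y volume S (S + T) :=
    hw'.congr fun u hu => (hyw u (by rw [uIoc_of_le hST] at hu; exact hu.1)).symm
  have hy := hy1.trans hy2
  have hprim1 : ∀ u ∈ Icc 0 S, ∫ r in (0:ℝ)..u, y r = ∫ r in (0:ℝ)..u, v r := fun u hu =>
    intervalIntegral.integral_congr fun r hr => hyv r (by
      rw [uIcc_of_le hu.1] at hr; exact hr.2.trans hu.2)
  have hprim2 : ∀ u ∈ Icc S (S + T), ∫ r in (0:ℝ)..u, y r = p.1 + ∫ r in (0:ℝ)..(u - S), w r := by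
    intro u hu
    have hsub : IntervalIntegrable y volume S u :=
      hy2.mono_set (by rw [uIcc_of_le hu.1, uIcc_of_le hST]; exact Icc_subset_Icc_right hu.2)
    rw [← intervalIntegral.integral_add_adjacent_intervals hy1 hsub, hprim1 S ⟨hS, le_rfl⟩, hpx]
    congr 1
    have h1 : ∫ r in S..u, y r = ∫ r in S..u, w (r - S) := by
      refine intervalIntegral.integral_congr_ae (Filter.Eventually.of_forall fun r hr => ?_)
      rw [uIoc_of_le hu.1] at hr
      exact hyw r hr.1
    rw [h1, intervalIntegral.integral_comp_sub_right, sub_self]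
  refine ⟨S + T, y, by linarith, hy, ?_, ?_, ?_⟩
  · rw [hprim2 _ ⟨hST, le_rfl⟩, add_sub_cancel_left, ← hqx]
    rfl
  · have hint : IntervalIntegrable (fun u => 2 * symp (∫ r in (0:ℝ)..u, y r) (y u)) volume
        0 (S + T) := (intervalIntegrable_symp (continuousOn_primitive hy) hy).const_mul 2
    have hsub1 : uIcc 0 S ⊆ uIcc 0 (S + T) := by
      rw [uIcc_of_le hS, uIcc_of_le (by linarith)]; exact Icc_subset_Icc_right hST
    have hsub2 : uIcc S (S + T) ⊆ uIcc 0 (S + T) := by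
      rw [uIcc_of_le hST, uIcc_of_le (by linarith)]; exact Icc_subset_Icc_left hS
    rw [← intervalIntegral.integral_add_adjacent_intervals (hint.mono_set hsub1)
      (hint.mono_set hsub2)]
    have h1 : ∫ u in (0:ℝ)..S, 2 * symp (∫ r in (0:ℝ)..u, y r) (y u) = p.2 := by
      rw [hpt]
      refine intervalIntegral.integral_congr fun u hu => ?_
      rw [uIcc_of_le hS] at hu
      simp only [hprim1 u hu, hyv u hu.2]
    have h2 : ∫ u in S..(S + T), 2 * symp (∫ r in (0:ℝ)..u, y r) (y u) =
        ∫ u in S..(S + T), 2 * symp (p.1 + ∫ r in (0:ℝ)..(u - S), w r) (w (u - S)) := by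
      refine intervalIntegral.integral_congr_ae (Filter.Eventually.of_forall fun u hu => ?_)
      rw [uIoc_of_le hST] at hu
      simp only [hprim2 u ⟨hu.1.le, hu.2⟩, hyw u hu.1]
    rw [h1, h2, intervalIntegral.integral_comp_sub_right
      (fun u => 2 * symp (p.1 + ∫ r in (0:ℝ)..u, w r) (w u)) S, sub_self, add_sub_cancel_left,
      integral_symp_add _ (continuousOn_primitive hw) hw, ← hqt, ← hqx]
    simp only [hmul]
    ring
  · rw [← intervalIntegral.integral_add_adjacent_intervals (hN.intervalIntegrable_comp hy1)
      (hN.intervalIntegrable_comp hy2)]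
    congr 1
    · refine intervalIntegral.integral_congr fun u hu => ?_
      rw [uIcc_of_le hS] at hu
      simp only [hyv u hu.2]
    · have h2 : ∫ u in S..(S + T), N (y u) = ∫ u in S..(S + T), N (w (u - S)) := by
        refine intervalIntegral.integral_congr_ae (Filter.Eventually.of_forall fun u hu => ?_)
        rw [uIoc_of_le hST] at hu
        simp only [hyw u hu.1]
      rw [h2, intervalIntegral.integral_comp_sub_right (fun u => N (w u)) S, sub_self,
        add_sub_cancel_left]

theorem Reach.nonneg (hN : IsNorm N) {p : Heis n} {L : ℝ} (hp : Reach N p L) : 0 ≤ L := by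
  obtain ⟨T, v, hT, -, -, -, rfl⟩ := hp
  exact intervalIntegral.integral_nonneg hT fun u _ => hN.nonneg _

theorem Reach.map_fst_le (hN : IsNorm N) (hsm : SmoothNorm N) {p : Heis n} {L : ℝ}
    (hp : Reach N p L) : N p.1 ≤ L := by
  obtain ⟨T, v, hT, hv, hx, -, rfl⟩ := hp
  rw [hx]
  exact hN.map_integral_le hsm hT hv

theorem exists_abs_snd_le (hN : IsNorm N) :
    ∃ C : ℝ, 0 ≤ C ∧ ∀ (p : Heis n) (L : ℝ), Reach N p L → |p.2| ≤ C * L ^ 2 := by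
  obtain ⟨K, hK, hsymp⟩ := exists_abs_symp_le n
  obtain ⟨C, hC, hnorm⟩ := hN.exists_norm_le
  refine ⟨2 * K * C ^ 2, by positivity, ?_⟩
  rintro p L ⟨T, v, hT, hv, -, ht, rfl⟩
  set L := ∫ u in (0:ℝ)..T, N (v u) with hL
  have hNi := hN.intervalIntegrable_comp hv
  have hx : ∀ u ∈ Icc 0 T, ‖∫ r in (0:ℝ)..u, v r‖ ≤ C * L := by
    intro u hu
    have hs : uIcc 0 u ⊆ uIcc 0 T := by
      rw [uIcc_of_le hu.1, uIcc_of_le hT]; exact Icc_subset_Icc_right hu.2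
    calc ‖∫ r in (0:ℝ)..u, v r‖ ≤ ∫ r in (0:ℝ)..u, C * N (v r) :=
          intervalIntegral.norm_integral_le_of_norm_le hu.1
            (Filter.Eventually.of_forall fun r _ => hnorm _) ((hNi.mono_set hs).const_mul C)
      _ = C * ∫ r in (0:ℝ)..u, N (v r) := intervalIntegral.integral_const_mul _ _
      _ ≤ C * L := by
          gcongr
          rw [hL, ← intervalIntegral.integral_add_adjacent_intervals (hNi.mono_set hs)
            (hNi.mono_set (c := u) (d := T) (by
              rw [uIcc_of_le hu.2, uIcc_of_le hT]; exact Icc_subset_Icc_left hu.1))]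
          have : 0 ≤ ∫ r in u..T, N (v r) :=
            intervalIntegral.integral_nonneg hu.2 fun _ _ => hN.nonneg _
          linarith
  rw [ht, ← Real.norm_eq_abs]
  calc ‖∫ u in (0:ℝ)..T, 2 * symp (∫ r in (0:ℝ)..u, v r) (v u)‖
      ≤ ∫ u in (0:ℝ)..T, (2 * K * C ^ 2 * L) * N (v u) := by
        refine intervalIntegral.norm_integral_le_of_norm_le hT
          (Filter.Eventually.of_forall fun u hu => ?_) (hNi.const_mul _)
        rw [Real.norm_eq_abs, abs_mul, abs_two]
        have h1 := hsymp (∫ r in (0:ℝ)..u, v r) (v u)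
        have h2 := mul_le_mul (hx u ⟨hu.1.le, hu.2⟩) (hnorm (v u)) (norm_nonneg _)
          ((norm_nonneg _).trans (hx u ⟨hu.1.le, hu.2⟩))
        have h3 := mul_le_mul_of_nonneg_left h2 hK
        linarith
    _ = 2 * K * C ^ 2 * L ^ 2 := by
        rw [intervalIntegral.integral_const_mul, ← hL]; ring

/-- Conjugating by a small horizontal element changes the vertical coordinate at a cost that is
inversely proportional to the horizontal displacement. -/
theorem exists_reach_straighten (hN : IsNorm N) :
    ∃ C : ℝ, 0 ≤ C ∧ ∀ (p q : Heis n) (w : V n) (τ L M : ℝ), Reach N p L → Reach N q M →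
      p.1 + w + q.1 ≠ 0 →
      ∃ R ≤ L + N w + M + C * |τ| / ‖p.1 + w + q.1‖, Reach N (hmul (hmul p (w, τ)) q) R := by
  obtain ⟨C, hC, hle⟩ := hN.exists_le_norm
  refine ⟨C / 2, by positivity, fun p q w τ L M hp hq hz => ?_⟩
  set z := p.1 + w + q.1 with hzdef
  have hzp : 0 < ‖z‖ := norm_pos_iff.2 hz
  set u : V n := (τ / (4 * ‖z‖ ^ 2)) • Jmat n z with hu
  have hsymp : 4 * symp u z = τ := by
    rw [hu, symp_smul_left, symp_Jmat_self]; field_simp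
  have hNu : N u ≤ C * |τ| / (4 * ‖z‖) := by
    refine (hle u).trans (le_of_eq ?_)
    rw [hu, norm_smul, norm_Jmat, Real.norm_eq_abs, abs_div,
      abs_of_pos (show 0 < 4 * ‖z‖ ^ 2 by positivity)]
    field_simp
  have hr := ((((reach_segment (N := N) u).mul hN hp).mul hN (reach_segment w)).mul hN hq).mul hN
    (reach_segment (-u))
  rw [hN.map_neg] at hr
  have heq : hmul (hmul (hmul (hmul (u, 0) p) (w, 0)) q) (-u, 0) = hmul (hmul p (w, τ)) q := by
    refine Prod.ext ?_ ?_
    · simp only [hmul]; abel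
    · rw [hzdef] at hsymp
      simp only [hmul, symp_add_left, symp_add_right, symp_neg_right, symp_self] at hsymp ⊢
      rw [symp_swap p.1 u, symp_swap w u, symp_swap q.1 u]
      linarith
  rw [heq] at hr
  refine ⟨_, ?_, hr⟩
  have : C / 2 * |τ| / ‖z‖ = C * |τ| / (4 * ‖z‖) + C * |τ| / (4 * ‖z‖) := by
    field_simp; ring
  linarith

theorem exists_reach_le (hN : IsNorm N) (e : V n) (he : ‖e‖ = 1) :
    ∃ C : ℝ, 0 ≤ C ∧ ∀ (z : V n) (τ : ℝ), ∃ R ≤ N z + C * √|τ|, Reach N (z, τ) R := by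
  have hN0 := hN.nonneg
  refine ⟨N (Jmat n e) + N e, add_nonneg (hN0 _) (hN0 _), fun z τ => ?_⟩
  obtain ⟨σ, hσ, hσ'⟩ : ∃ σ : ℝ, |σ| = 1 ∧ σ * |τ| = τ := by
    rcases le_total 0 τ with h | h
    · exact ⟨1, by simp, by rw [abs_of_nonneg h, one_mul]⟩
    · exact ⟨-1, by simp, by rw [abs_of_nonpos h]; ring⟩
  set r := √|τ| / 2 with hr
  have hr0 : 0 ≤ r := by positivity
  have hr2 : 4 * r ^ 2 = |τ| := by
    rw [hr, div_pow, Real.sq_sqrt (abs_nonneg _)]; ring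
  set a : V n := r • Jmat n e with ha
  set b : V n := (σ * r) • e with hb
  have hNa : N a = r * N (Jmat n e) := by rw [ha, hN.smul, abs_of_nonneg hr0]
  have hNb : N b = r * N e := by rw [hb, hN.smul, abs_mul, hσ, one_mul, abs_of_nonneg hr0]
  have hab : 4 * symp a b = τ := by
    rw [ha, hb, symp_smul_left, symp_smul_right, symp_Jmat_self, he, ← hσ', ← hr2]; ring
  have hloop := ((((reach_segment (N := N) z).mul hN (reach_segment a)).mul hN
    (reach_segment b)).mul hN (reach_segment (-a))).mul hN (reach_segment (-b))
  have heq : hmul (hmul (hmul (hmul (z, 0) (a, 0)) (b, 0)) (-a, 0)) (-b, 0) = (z, τ) := by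
    refine Prod.ext ?_ ?_
    · simp only [hmul]; abel
    · simp only [hmul, symp_add_left, symp_neg_right, symp_neg_left, symp_self]
      rw [symp_swap b a]
      linarith
  rw [heq] at hloop
  refine ⟨_, le_of_eq ?_, hloop⟩
  rw [hN.map_neg, hN.map_neg, hNa, hNb, hr]
  ring

end Reach

section Geodesic

variable {n : ℕ} {N : V n → ℝ} {γ : ℝ → Heis n}

theorem dist_le_of_reach (hN : IsNorm N) (hgeo : ∀ s s' : ℝ, dSF n N (γ s) (γ s') = |s - s'|)
    {s s' L : ℝ} (h : Reach N (hmul (hinv (γ s)) (γ s')) L) : |s - s'| ≤ L := by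
  rw [← hgeo, dSF_eq_sInf_reach]
  exact csInf_le ⟨0, fun _ h => Reach.nonneg hN h⟩ h

theorem exists_reach_lt (hgeo : ∀ s s' : ℝ, dSF n N (γ s) (γ s') = |s - s'|)
    {s s' K : ℝ} (hne : s ≠ s') (hK : |s - s'| < K) :
    ∃ L < K, Reach N (hmul (hinv (γ s)) (γ s')) L := by
  have h := hgeo s s'
  rw [dSF_eq_sInf_reach] at h
  have hnonempty : {L | Reach N (hmul (hinv (γ s)) (γ s')) L}.Nonempty := by
    by_contra hemp
    rw [not_nonempty_iff_eq_empty] at hemp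
    rw [hemp, Real.sInf_empty] at h
    exact (abs_pos.2 (sub_ne_zero.2 hne)).ne h
  obtain ⟨L, hL, hlt⟩ := exists_lt_of_csInf_lt hnonempty (h.trans_lt hK)
  exact ⟨L, hlt, hL⟩

theorem map_fst_sub_le (hN : IsNorm N) (hsm : SmoothNorm N)
    (hgeo : ∀ s s' : ℝ, dSF n N (γ s) (γ s') = |s - s'|) (s s' : ℝ) :
    N ((γ s').1 - (γ s).1) ≤ |s - s'| := by
  rcases eq_or_ne s s' with rfl | hne
  · simp [hN.map_zero]
  · refine le_of_forall_pos_lt_add fun ε hε => ?_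
    obtain ⟨L, hL, hr⟩ := exists_reach_lt hgeo hne (lt_add_of_pos_right |s - s'| hε)
    have := hr.map_fst_le hN hsm
    simp only [hmul, hinv, neg_add_eq_sub] at this
    exact this.trans_lt hL

theorem exists_abs_snd_sub_le (hN : IsNorm N)
    (hgeo : ∀ s s' : ℝ, dSF n N (γ s) (γ s') = |s - s'|) :
    ∃ C : ℝ, 0 ≤ C ∧ ∀ s s' : ℝ, |(γ s').2 - (γ s).2 - 2 * symp (γ s).1 (γ s').1| ≤
      C * |s - s'| ^ 2 := by
  obtain ⟨C, hC, h⟩ := exists_abs_snd_le hN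
  refine ⟨4 * C, by positivity, fun s s' => ?_⟩
  rcases eq_or_ne s s' with rfl | hne
  · simp [symp_self]
  · have hpos : 0 < |s - s'| := abs_pos.2 (sub_ne_zero.2 hne)
    obtain ⟨L, hL, hr⟩ := exists_reach_lt hgeo hne (show |s - s'| < 2 * |s - s'| by linarith)
    have h1 := h _ _ hr
    have h2 : L ^ 2 ≤ (2 * |s - s'|) ^ 2 := pow_le_pow_left₀ (hr.nonneg hN) hL.le 2
    have h3 : (hmul (hinv (γ s)) (γ s')).2 =
        (γ s').2 - (γ s).2 - 2 * symp (γ s).1 (γ s').1 := by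
      simp only [hmul, hinv, symp_neg_left]; ring
    rw [h3] at h1
    calc _ ≤ C * L ^ 2 := h1
      _ ≤ C * (2 * |s - s'|) ^ 2 := by gcongr
      _ = _ := by ring

/-- The horizontal projection of an infinite geodesic is unbounded: otherwise the vertical
coordinate would grow at most linearly, and the distance at most like a square root. -/
theorem not_bounded_fst (hN : IsNorm N)
    (hgeo : ∀ s s' : ℝ, dSF n N (γ s) (γ s') = |s - s'|) :
    ∀ B : ℝ, ∃ s, B < ‖(γ s).1‖ := by
  by_contra! hB
  obtain ⟨B, hB⟩ := hB
  have hB0 : 0 ≤ B := (norm_nonneg _).trans (hB 0)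
  obtain ⟨K, hK, hsymp⟩ := exists_abs_symp_le n
  obtain ⟨C, hC, hvert⟩ := exists_abs_snd_sub_le hN hgeo
  obtain ⟨A, hA, hle⟩ := hN.exists_le_norm
  obtain ⟨e, he⟩ : ∃ e : V n, ‖e‖ = 1 := by
    by_contra! hno
    have hz : ∀ z : V n, z = 0 := fun z => by
      by_contra hz
      exact hno (‖z‖⁻¹ • z) (by simp [norm_smul, hz])
    obtain ⟨L, -, hr⟩ :=
      exists_reach_lt hgeo zero_ne_one (show |(0:ℝ) - 1| < 2 by norm_num)
    have hle := dist_le_of_reach hN hgeo hr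
    obtain ⟨T, v, -, -, -, -, rfl⟩ := hr
    norm_num [hz, hN.map_zero] at hle
  obtain ⟨D, hD, hreach⟩ := exists_reach_le hN e he
  set Q := K * B * B with hQ
  have hQ0 : 0 ≤ Q := by positivity
  have hsympB : ∀ s s', |symp (γ s).1 (γ s').1| ≤ Q := fun s s' =>
    (hsymp _ _).trans (by rw [hQ]; gcongr <;> exact hB _)
  have hstep : ∀ k : ℕ, |(γ k).2 - (γ 0).2| ≤ k * (C + 2 * Q) := by
    intro k
    induction k with
    | zero => simp
    | succ k ih =>
      have h1 := hvert k (k + 1)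
      have h2 := hsympB k (k + 1)
      rw [show |(k:ℝ) - (k + 1)| = 1 by simp] at h1
      push_cast
      rw [abs_le] at *
      constructor <;> nlinarith
  set E := C + 4 * Q with hE
  have hE0 : 0 ≤ E := by positivity
  have hdist : ∀ k : ℕ, (k : ℝ) ≤ A * (2 * B) + D * √((k + 1) * E) := by
    intro k
    obtain ⟨R, hR, hr⟩ := hreach (hmul (hinv (γ 0)) (γ k)).1 (hmul (hinv (γ 0)) (γ k)).2
    have h1 := dist_le_of_reach hN hgeo hr
    rw [zero_sub, abs_neg, Nat.abs_cast] at h1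
    refine (h1.trans hR).trans (add_le_add ?_ ?_)
    · refine (hle _).trans (mul_le_mul_of_nonneg_left ?_ hA)
      simp only [hmul, hinv]
      refine (norm_add_le _ _).trans ?_
      rw [norm_neg]
      linarith [hB 0, hB k]
    · refine mul_le_mul_of_nonneg_left (Real.sqrt_le_sqrt ?_) hD
      have h2 := hstep k
      have h3 := hsympB 0 k
      simp only [hmul, hinv, symp_neg_left]
      rw [abs_le] at *
      have hk : (0:ℝ) ≤ k := Nat.cast_nonneg k
      have hkQ : 0 ≤ (k:ℝ) * Q := by positivity
      constructor <;> nlinarith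
  obtain ⟨m, hm⟩ := exists_nat_gt (A * (2 * B) + D * √E + 2)
  have hDE : 0 ≤ D * √E := by positivity
  have hAB : 0 ≤ A * (2 * B) := by positivity
  have hm1 : (1:ℝ) ≤ m := by linarith
  have h := hdist (m ^ 2 - 1)
  have hcast : ((m ^ 2 - 1 : ℕ) : ℝ) = (m:ℝ) ^ 2 - 1 := by
    have : 1 ≤ m ^ 2 := Nat.one_le_pow _ _ (by exact_mod_cast hm1)
    push_cast [this]; ring
  rw [hcast, sub_add_cancel, Real.sqrt_mul (by positivity), Real.sqrt_sq (by positivity)] at h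
  nlinarith

/-- The horizontal projection of an infinite geodesic is a geodesic for `N`: a shortcut of the
projection could be lifted, correcting the vertical coordinate at arbitrarily small cost far
away. -/
theorem map_fst_sub_eq (hN : IsNorm N) (hsm : SmoothNorm N)
    (hgeo : ∀ s s' : ℝ, dSF n N (γ s) (γ s') = |s - s'|) {a b : ℝ} (hab : a < b) :
    N ((γ b).1 - (γ a).1) = b - a := by
  have hup := map_fst_sub_le hN hsm hgeo
  refine le_antisymm ((hup a b).trans_eq (by rw [abs_sub_comm, abs_of_pos (sub_pos.2 hab)])) ?_
  obtain ⟨C, hC, hstr⟩ := exists_reach_straighten hN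
  obtain ⟨A, hA, hnorm⟩ := hN.exists_norm_le
  refine le_of_forall_pos_le_add fun ε hε => ?_
  set w := (γ b).1 - (γ a).1 with hw
  set τ := (hmul (hinv (γ a)) (γ b)).2 with hτ
  obtain ⟨T, hT⟩ := not_bounded_fst hN hgeo
    (‖(γ a).1‖ + ‖(γ b).1‖ + A * (b - a) + 1 + C * |τ| / (ε / 2))
  have hfrac : 0 ≤ C * |τ| / (ε / 2) := by positivity
  have hba : 0 ≤ A * (b - a) := mul_nonneg hA (by linarith)
  have hz : ∀ s, s = a ∨ s = b → 0 < ‖(γ T).1 - (γ s).1‖ ∧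
      C * |τ| / ‖(γ T).1 - (γ s).1‖ ≤ ε / 2 := by
    intro s hs
    have h1 := norm_sub_norm_le (γ T).1 (γ s).1
    have h2 : ‖(γ s).1‖ ≤ ‖(γ a).1‖ + ‖(γ b).1‖ := by
      rcases hs with rfl | rfl
      · linarith [norm_nonneg (γ b).1]
      · linarith [norm_nonneg (γ a).1]
    have h3 : C * |τ| / (ε / 2) < ‖(γ T).1 - (γ s).1‖ := by linarith
    refine ⟨by linarith, ?_⟩
    rw [div_lt_iff₀ (by positivity)] at h3
    rw [div_le_iff₀ (by linarith)]
    linarith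
  have hout : T < a ∨ b < T := by
    by_contra! hin
    have h1 := hup a T
    rw [abs_sub_comm, abs_of_nonneg (sub_nonneg.2 hin.1)] at h1
    have h2 := norm_sub_norm_le (γ T).1 (γ a).1
    have h3 := hnorm ((γ T).1 - (γ a).1)
    have h4 : A * N ((γ T).1 - (γ a).1) ≤ A * (b - a) :=
      mul_le_mul_of_nonneg_left (by linarith [hin.2]) hA
    linarith [norm_nonneg (γ b).1]
  have hunit : Reach N ((0, 0) : Heis n) 0 := by
    simpa [hN.map_zero] using reach_segment (N := N) 0
  have hwτ : (w, τ) = hmul (hinv (γ a)) (γ b) := by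
    refine Prod.ext ?_ rfl
    simp [hw, hmul, hinv, neg_add_eq_sub]
  rcases hout with hTa | hbT
  · obtain ⟨L, hL, hr⟩ := exists_reach_lt hgeo hTa.ne
      (lt_add_of_pos_right |T - a| (half_pos hε))
    have hsum : (hmul (hinv (γ T)) (γ a)).1 + w + 0 = (γ b).1 - (γ T).1 := by
      simp only [hw, hmul, hinv]; abel
    obtain ⟨R, hR, hr'⟩ := hstr _ (0, 0) w τ L 0 hr hunit (by
      rw [hsum, ← norm_pos_iff, norm_sub_rev]; exact (hz b (Or.inr rfl)).1)
    have heq : hmul (hmul (hmul (hinv (γ T)) (γ a)) (w, τ)) (0, 0) =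
        hmul (hinv (γ T)) (γ b) := by
      rw [hwτ]
      refine Prod.ext ?_ ?_
      · simp only [hmul, hinv]; abel
      · simp only [hmul, hinv, symp_add_left, symp_add_right, symp_neg_left, symp_neg_right,
          symp_self, symp_zero_right]
        ring
    rw [heq] at hr'
    have h1 := dist_le_of_reach hN hgeo hr'
    have h2 := (hz b (Or.inr rfl)).2
    rw [hsum, norm_sub_rev] at hR
    rw [abs_of_neg (by linarith)] at h1 hL
    linarith
  · obtain ⟨L, hL, hr⟩ := exists_reach_lt hgeo hbT.ne
      (lt_add_of_pos_right |b - T| (half_pos hε))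
    have hsum : 0 + w + (hmul (hinv (γ b)) (γ T)).1 = (γ T).1 - (γ a).1 := by
      simp only [hw, hmul, hinv]; abel
    obtain ⟨R, hR, hr'⟩ := hstr (0, 0) _ w τ 0 L hunit hr (by
      rw [hsum, ← norm_pos_iff]; exact (hz a (Or.inl rfl)).1)
    have heq : hmul (hmul (0, 0) (w, τ)) (hmul (hinv (γ b)) (γ T)) =
        hmul (hinv (γ a)) (γ T) := by
      rw [hwτ]
      refine Prod.ext ?_ ?_
      · simp only [hmul, hinv]; abel
      · simp only [hmul, hinv, symp_add_left, symp_add_right, symp_neg_left, symp_neg_right,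
          symp_self, symp_zero_left]
        ring
    rw [heq] at hr'
    have h1 := dist_le_of_reach hN hgeo hr'
    have h2 := (hz a (Or.inl rfl)).2
    rw [hsum] at hR
    rw [abs_of_neg (by linarith)] at h1 hL
    linarith

end Geodesic

/-- An infinite geodesic of a strictly convex norm is an affine line. -/
theorem eq_add_smul_of_map_sub_eq {n : ℕ} {N : V n → ℝ} (hN : IsNorm N)
    (hsc : StrictlyConvexNorm N) {x : ℝ → V n}
    (hx : ∀ a b : ℝ, a < b → N (x b - x a) = b - a) (s : ℝ) :
    x s = x 0 + s • (x 1 - x 0) := by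
  have key : ∀ a b c : ℝ, a < b → b < c → (b - a) • (x c - x b) = (c - b) • (x b - x a) := by
    intro a b c hab hbc
    have hne : ∀ a b, a < b → x b - x a ≠ 0 := fun a b h h0 => by
      have := hx a b h
      rw [h0, hN.map_zero] at this
      linarith
    obtain ⟨α, hα, h⟩ := hsc (x b - x a) (x c - x b) (hne _ _ hab) (hne _ _ hbc) (by
      rw [show x b - x a + (x c - x b) = x c - x a by abel, hx a c (hab.trans hbc), hx a b hab,
        hx b c hbc]
      ring)
    have h1 := hx b c hbc
    rw [h, hN.smul, hx a b hab, abs_of_pos hα] at h1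
    rw [h, smul_smul, ← h1, mul_comm α]
  rcases lt_trichotomy s 0 with h | rfl | h
  · have := key s 0 1 h one_pos
    simp only [zero_sub, sub_zero, one_smul] at this
    have h2 : s • (x 1 - x 0) = x s - x 0 := by
      rw [← neg_inj, ← neg_smul, this]; abel
    rw [h2]; abel
  · simp
  · rcases lt_trichotomy s 1 with h' | rfl | h'
    · have := key 0 s 1 h h'
      rw [sub_zero] at this
      have h2 : s • (x 1 - x 0) = x s - x 0 := by
        calc s • (x 1 - x 0) = s • (x 1 - x s) + s • (x s - x 0) := by
              rw [← smul_add]; congr 1; abel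
          _ = x s - x 0 := by rw [this, ← add_smul]; simp
      rw [h2]; abel
    · simp
    · have := key 0 1 s one_pos h'
      rw [sub_zero, one_smul, sub_smul, one_smul] at this
      have h2 : s • (x 1 - x 0) = x s - x 0 := by
        rw [← sub_eq_zero] at this ⊢
        rw [← neg_eq_zero, ← this]; abel
      rw [h2]; abel

theorem eq_of_abs_sub_le_sq {f : ℝ → ℝ} {C : ℝ} (h : ∀ a b, |f b - f a| ≤ C * |a - b| ^ 2)
    (a b : ℝ) : f a = f b := by
  have hd : ∀ a, HasDerivAt f 0 a := fun a => by
    rw [hasDerivAt_iff_isLittleO]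
    have h1 : (fun b => f b - f a - (b - a) • (0:ℝ)) =O[nhds a] fun b => (b - a) ^ 2 :=
      Asymptotics.IsBigO.of_bound C (Filter.Eventually.of_forall fun b => by
        simpa [abs_sub_comm] using h a b)
    refine h1.trans_isLittleO ?_
    have h2 : Filter.Tendsto (fun b => b - a) (nhds a) (nhds 0) := by
      have : Continuous fun b => b - a := by fun_prop
      simpa using this.tendsto a
    exact (Asymptotics.isLittleO_pow_id one_lt_two).comp_tendsto h2
  exact is_const_of_deriv_eq_zero (fun a => (hd a).differentiableAt) (fun a => (hd a).deriv) a b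

/-- If `N` is a strictly convex and smooth norm, then every infinite
geodesic of `(ℍⁿ, d_SF)` is a horizontal line `s ↦ g₀ * (s w, 0)` with `N w = 1`. -/
theorem stmt17 (n : ℕ) (N : V n → ℝ) (hN : IsNorm N) (hsc : StrictlyConvexNorm N)
    (hsm : SmoothNorm N) (γ : ℝ → Heis n)
    (hgeo : ∀ s s' : ℝ, dSF n N (γ s) (γ s') = |s - s'|) :
    ∃ (g₀ : Heis n) (w : V n), N w = 1 ∧ ∀ s : ℝ, γ s = hmul g₀ (s • w, (0 : ℝ)) := by
  have hx : ∀ a b : ℝ, a < b → N ((γ b).1 - (γ a).1) = b - a := fun a b hab =>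
    map_fst_sub_eq hN hsm hgeo hab
  have hline := eq_add_smul_of_map_sub_eq hN hsc (x := fun s => (γ s).1) hx
  obtain ⟨C, -, hvert⟩ := exists_abs_snd_sub_le hN hgeo
  set w := (γ 1).1 - (γ 0).1 with hw
  have hconst := eq_of_abs_sub_le_sq (f := fun s => (γ s).2 - s * (2 * symp (γ 0).1 w)) (C := C)
    fun a b => by
      refine le_trans (le_of_eq ?_) (hvert a b)
      have hsymp : symp (γ a).1 (γ b).1 = (b - a) * symp (γ 0).1 w := by
        rw [hline a, hline b]
        simp only [symp_add_left, symp_add_right, symp_smul_left, symp_smul_right, symp_self]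
        rw [symp_swap w]
        ring
      rw [hsymp]
      congr 1
      ring
  refine ⟨γ 0, w, by simpa using hx 0 1 one_pos, fun s => Prod.ext (hline s) ?_⟩
  have := hconst s 0
  simp only [hmul, symp_smul_right]
  linarith

end
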